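/- arXiv:2002.10035 — 2 statements merged into one kernel-verified Lean document; each statement's English description precedes it below -/
import Mathlib

section
/- Let q be a prime power and suppose there exists a set of N four-dimensional subspaces of F_q^8 whose pairwise subspace distance is at least 4. Then there exists a set of N·q^{15} + (q^{15} + 2q^{13} + 3q^{12} + 5q^{11} + q^{10} + 3q^9 + 6q^8 + 7q^7 + 5q^6 + 3q^5 + 3q^4 + q^3 + 1) four-dimensional subspaces of F_q^{13} whose pairwise subspace distance is at least 4; in other words, A_q(13,4,4) ≥ A_q(8,4,4)·q^{15} + q^{15} + 2q^{13} + 3q^{12} + 5q^{11} + q^{10} + 3q^9 + 6q^8 + 7q^7 + 5q^6 + 3q^5 + 3q^4 + q^3 + 1. -/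
/-- The subspace distance `d_S(U,W) = 2·dim(U+W) − dim U − dim W` between two
subspaces of an `F`-vector space. -/
noncomputable def subspaceDist {F V : Type*} [Field F] [AddCommGroup V] [Module F V]
    (U W : Submodule F V) : ℕ :=
  2 * Module.finrank F ↥(U ⊔ W) - Module.finrank F ↥U - Module.finrank F ↥W

/-- The row space `im(A)` of a matrix `A`, i.e. the span of its rows. -/
def rowSpace {F : Type*} [Field F] {k n : ℕ} (A : Matrix (Fin k) (Fin n) F) :
    Submodule F (Fin n → F) :=
  Submodule.span F (Set.range fun i : Fin k => A i)

/-- Horizontal concatenation `(U | M)` of two matrices with the same number of rows. -/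
def hcat {F : Type*} [Field F] {k n1 n2 : ℕ} (U : Matrix (Fin k) (Fin n1) F)
    (M : Matrix (Fin k) (Fin n2) F) : Matrix (Fin k) (Fin (n1 + n2)) F :=
  Matrix.of fun i => Fin.append (U i) (M i)

/-- The projection of `F^(n1+n2)` onto the first `n1` coordinates. -/
noncomputable def proj1 (F : Type*) [Field F] (n1 n2 : ℕ) :
    (Fin (n1 + n2) → F) →ₗ[F] (Fin n1 → F) :=
  LinearMap.funLeft F F (Fin.castAdd n2)

open Module

section Intersection

variable {F V W : Type*} [Field F] [AddCommGroup V] [Module F V] [AddCommGroup W] [Module F W]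

theorem finrank_le_finrank_map_add_finrank_inf_ker [FiniteDimensional F V] (Z : Submodule F V)
    (π : V →ₗ[F] W) :
    finrank F Z ≤ finrank F (Z.map π) + finrank F ↥(Z ⊓ LinearMap.ker π) := by
  have h := (π.domRestrict Z).finrank_range_add_finrank_ker
  rw [LinearMap.range_domRestrict] at h
  have hker : finrank F (LinearMap.ker (π.domRestrict Z)) ≤
      finrank F ↥(Z ⊓ LinearMap.ker π) := by
    rw [← Submodule.finrank_map_subtype_eq Z (LinearMap.ker (π.domRestrict Z))]
    refine Submodule.finrank_mono ?_
    rintro _ ⟨x, hx, rfl⟩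
    exact ⟨x.2, hx⟩
  omega

theorem finrank_inf_lt_of_ne [FiniteDimensional F V] {X Y : Submodule F V}
    (hX : finrank F X = finrank F Y) (hne : X ≠ Y) : finrank F ↥(X ⊓ Y) < finrank F X := by
  refine lt_of_le_of_ne (Submodule.finrank_mono inf_le_left) fun h => hne ?_
  have h1 := Submodule.eq_of_le_of_finrank_eq (inf_le_left : X ⊓ Y ≤ X) h
  have h2 := Submodule.eq_of_le_of_finrank_eq (inf_le_right : X ⊓ Y ≤ Y) (h.trans hX)
  exact h1.symm.trans h2

theorem four_le_subspaceDist_iff [FiniteDimensional F V] {X Y : Submodule F V}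
    (hX : finrank F X = 4) (hY : finrank F Y = 4) :
    4 ≤ subspaceDist X Y ↔ finrank F ↥(X ⊓ Y) ≤ 2 := by
  have := Submodule.finrank_sup_add_finrank_inf_eq X Y
  unfold subspaceDist
  omega

end Intersection

section FiniteFieldExtension

variable {F K : Type*} [Field F] [Fintype F] [Field K] [Algebra F K]

theorem exists_fieldExtension (F : Type) [Field F] [Finite F] (n : ℕ) [NeZero n] :
    ∃ (K : Type) (_ : Field K) (_ : Algebra F K), Finite K ∧ finrank F K = n := by
  obtain ⟨p, hp⟩ := CharP.exists F
  have : Fact p.Prime := ⟨CharP.char_is_prime F p⟩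
  exact ⟨FiniteField.Extension F p n, inferInstance, inferInstance, inferInstance,
    FiniteField.finrank_extension F p n⟩

/-- The linearized polynomial map `x ↦ ∑ j < k, a j * x ^ (q ^ j)`, where `q` is the order
of `F`. -/
noncomputable def linearizedMap (F K : Type*) [Field F] [Fintype F] [Field K] [Algebra F K]
    {k : ℕ} (a : Fin k → K) : K →ₗ[F] K :=
  ∑ j : Fin k, a j • (FiniteField.frobeniusAlgHom F K ^ (j : ℕ)).toLinearMap

theorem linearizedMap_apply {k : ℕ} (a : Fin k → K) (x : K) :
    linearizedMap F K a x = ∑ j : Fin k, a j * x ^ (Fintype.card F ^ (j : ℕ)) := by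
  simp [linearizedMap, FiniteField.coe_frobeniusAlgHom, AlgHom.coe_pow, pow_iterate]

theorem linearizedMap_sub {k : ℕ} (a b : Fin k → K) :
    linearizedMap F K (a - b) = linearizedMap F K a - linearizedMap F K b := by
  ext x
  simp [linearizedMap_apply, sub_mul]

open Polynomial in
theorem finrank_ker_linearizedMap_le [Finite K] {k : ℕ} {a : Fin (k + 1) → K} (ha : a ≠ 0) :
    finrank F (LinearMap.ker (linearizedMap F K a)) ≤ k := by
  classical
  set q := Fintype.card F with hq
  have hq1 : 1 < q := Fintype.one_lt_card
  let P : K[X] := ∑ j : Fin (k + 1), monomial (q ^ (j : ℕ)) (a j)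
  have hcoeff (i : Fin (k + 1)) : P.coeff (q ^ (i : ℕ)) = a i := by
    simp only [P, finsetSum_coeff, coeff_monomial]
    rw [Finset.sum_eq_single i]
    · simp
    · intro j _ hj
      rw [if_neg]
      intro h
      exact hj (Fin.ext (Nat.pow_right_injective hq1 h))
    · simp
  have hP : P ≠ 0 := by
    rintro h
    refine ha (funext fun i => ?_)
    rw [← hcoeff, h]
    simp
  have hdeg : P.natDegree ≤ q ^ k := by
    refine natDegree_sum_le_of_forall_le _ _ fun j _ => (natDegree_monomial_le _).trans ?_
    exact Nat.pow_le_pow_right hq1.le (Nat.lt_succ_iff.mp j.2)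
  have hsub : (LinearMap.ker (linearizedMap F K a) : Set K) ⊆ P.roots.toFinset := by
    intro x hx
    have hx' : linearizedMap F K a x = 0 := hx
    rw [linearizedMap_apply] at hx'
    simp only [Finset.mem_coe, Multiset.mem_toFinset, mem_roots hP, IsRoot.def]
    simpa [P, eval_finsetSum] using hx'
  have hcard : Nat.card (LinearMap.ker (linearizedMap F K a)) ≤ q ^ k := by
    calc Nat.card (LinearMap.ker (linearizedMap F K a))
        = (LinearMap.ker (linearizedMap F K a) : Set K).ncard := rfl
      _ ≤ (P.roots.toFinset : Set K).ncard := Set.ncard_le_ncard hsub (Finset.finite_toSet _)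
      _ = P.roots.toFinset.card := Set.ncard_coe_finset _
      _ ≤ P.roots.card := Multiset.toFinset_card_le _
      _ ≤ P.natDegree := card_roots' P
      _ ≤ q ^ k := hdeg
  rw [Module.natCard_eq_pow_finrank (K := F), Nat.card_eq_fintype_card] at hcard
  exact (Nat.pow_le_pow_iff_right hq1).mp hcard

omit [Fintype F] in
theorem exists_pencil (h : 1 < finrank F K) :
    ∃ α : K × K →ₗ[F] F × F →ₗ[F] K,
      (∀ p, p ≠ 0 → α p ≠ 0) ∧ ∀ m x, m ≠ 0 → α (m, 0) x = 0 → x = 0 := by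
  obtain ⟨ω, hω⟩ : ∃ ω : K, ω ∉ (⊥ : Subalgebra F K) := by
    by_contra! hall
    have htop : (⊥ : Subalgebra F K) = ⊤ := eq_top_iff.2 fun x _ => hall x
    have h1 := Subalgebra.finrank_bot (F := F) (E := K)
    rw [htop, subalgebra_top_finrank_eq_submodule_top_finrank, finrank_top] at h1
    omega
  let l : F × F →ₗ[F] K :=
    (LinearMap.fst F F F).smulRight 1 + (LinearMap.snd F F F).smulRight ω
  let α : K × K →ₗ[F] F × F →ₗ[F] K := LinearMap.mk₂ F
    (fun p x => p.1 * l x + x.2 • p.2)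
    (by intro p p' x; simp [add_mul]; ring)
    (by intro c p x; simp [smul_comm c])
    (by intro p x y; rw [map_add]; simp only [Prod.snd_add, add_smul]; ring)
    (by intro c p x; simp [mul_smul])
  refine ⟨α, fun p hp h0 => hp ?_, fun m x hm hx => ?_⟩
  · have h1 : α p (1, 0) = 0 := by rw [h0]; rfl
    have h2 : α p (0, 1) = 0 := by rw [h0]; rfl
    have h1' : p.1 = 0 := by simpa [α, l] using h1
    have h2' : p.2 = 0 := by simpa [α, l, h1'] using h2
    exact Prod.ext h1' h2'
  · have hl : l x = 0 := by simpa [α, hm] using hx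
    have hl' : x.1 • (1 : K) + x.2 • ω = 0 := by simpa [l] using hl
    have hx2 : x.2 = 0 := by
      by_contra hx2
      refine hω ?_
      have : ω = algebraMap F K (-(x.2⁻¹ * x.1)) := by
        rw [Algebra.algebraMap_eq_smul_one, neg_smul, mul_smul, eq_neg_of_add_eq_zero_left hl',
          smul_neg, neg_neg, smul_smul, inv_mul_cancel₀ hx2, one_smul]
      rw [this]
      exact Subalgebra.algebraMap_mem _ _
    have hx1 : x.1 = 0 := by simpa [hx2] using hl'
    exact Prod.ext hx1 hx2

omit [Fintype F] in
theorem exists_pencil_transverse {E : Type*} [AddCommGroup E] [Module F E] [FiniteDimensional F E]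
    (h : 1 < finrank F K) (C : Submodule F E) (hC : finrank F C + finrank F K = finrank F E) :
    ∃ ψ : K →ₗ[F] F × F →ₗ[F] E, ∀ c x, c ≠ 0 → ψ c x ∈ C → x = 0 := by
  obtain ⟨α, -, hα⟩ := exists_pencil (F := F) (K := K) h
  obtain ⟨D, hD⟩ := Submodule.exists_isCompl C
  have : FiniteDimensional F K := Module.finite_of_finrank_pos (by omega)
  have hdim := Submodule.finrank_add_eq_of_isCompl hD
  let e : K ≃ₗ[F] D := LinearEquiv.ofFinrankEq _ _ (by omega)
  let ψ : K →ₗ[F] F × F →ₗ[F] E :=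
    (LinearMap.compRight F (D.subtype ∘ₗ e.toLinearMap)) ∘ₗ α ∘ₗ LinearMap.inl F K K
  refine ⟨ψ, fun c x hc hx => hα c x hc ?_⟩
  have hx' : ((e (α (c, 0) x) : D) : E) ∈ C := hx
  have h0 := Submodule.disjoint_def.1 hD.disjoint _ hx' (e (α (c, 0) x)).2
  simpa using h0

omit [Fintype F] in
theorem exists_span_pair_eq {E : Type*} [AddCommGroup E] [Module F E] {C : Submodule F E}
    (hC : finrank F C = 2) : ∃ x y : E, C = Submodule.span F {x, y} := by
  have : FiniteDimensional F C := Module.finite_of_finrank_pos (by omega)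
  let b := finBasisOfFinrankEq F C hC
  refine ⟨b 0, b 1, ?_⟩
  have h := congrArg (Submodule.map C.subtype) b.span_eq
  rw [Submodule.map_span, Submodule.map_top, Submodule.range_subtype] at h
  refine h.symm.trans (congrArg _ ?_)
  ext z
  simp [Fin.exists_fin_two, eq_comm]

/-- The Moore determinant `x * y ^ q - x ^ q * y`, where `q` is the order of `F`. -/
noncomputable def mooreDet (F K : Type*) [Field F] [Fintype F] [Field K] [Algebra F K]
    (x : K) : K →ₗ[F] K :=
  linearizedMap F K ![-x ^ Fintype.card F, x]

theorem mooreDet_apply (x y : K) :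
    mooreDet F K x y = x * y ^ Fintype.card F - x ^ Fintype.card F * y := by
  simp [mooreDet, linearizedMap_apply, Fin.sum_univ_two]
  ring

theorem mem_span_singleton_of_mooreDet_eq_zero [Finite K] {x y : K} (hx : x ≠ 0)
    (h : mooreDet F K x y = 0) : y ∈ Submodule.span F {x} := by
  have hle : Submodule.span F {x} ≤ LinearMap.ker (mooreDet F K x) := by
    rw [Submodule.span_singleton_le_iff_mem, LinearMap.mem_ker, mooreDet_apply]
    ring
  have hne : ![-x ^ Fintype.card F, x] ≠ 0 := fun h0 => hx (congrFun h0 1)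
  have heq := Submodule.eq_of_le_of_finrank_le hle
    ((finrank_ker_linearizedMap_le hne).trans_eq (finrank_span_singleton hx).symm)
  rw [heq]
  exact h

theorem exists_span_pair_eq_and_mooreDet_eq {x y z : K} (hz : z ≠ 0)
    (h : z ∈ Submodule.span F {x, y}) :
    ∃ w, Submodule.span F {x, y} = Submodule.span F {z, w} ∧
      mooreDet F K z w = mooreDet F K x y := by
  have hpow (c : F) (u : K) : (c • u) ^ Fintype.card F = c • u ^ Fintype.card F :=
    map_smul (FiniteField.frobeniusAlgHom F K) c u
  have hadd (u v : K) : (u + v) ^ Fintype.card F = u ^ Fintype.card F + v ^ Fintype.card F :=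
    map_add (FiniteField.frobeniusAlgHom F K) u v
  obtain ⟨a, b, rfl⟩ := Submodule.mem_span_pair.1 h
  rcases eq_or_ne a 0 with rfl | ha
  · have hb : b ≠ 0 := by rintro rfl; simp at hz
    refine ⟨-(b⁻¹ • x), le_antisymm ?_ ?_, ?_⟩
    · rw [Submodule.span_le, Set.pair_subset_iff]
      refine ⟨Submodule.mem_span_pair.2 ⟨0, -b, ?_⟩, Submodule.mem_span_pair.2 ⟨b⁻¹, 0, ?_⟩⟩ <;>
        simp [smul_smul, hb]
    · rw [Submodule.span_le, Set.pair_subset_iff]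
      refine ⟨h, Submodule.mem_span_pair.2 ⟨-b⁻¹, 0, ?_⟩⟩
      simp
    · rw [map_neg, map_smul, mooreDet_apply, mooreDet_apply, zero_smul, zero_add, hpow,
        smul_mul_assoc, smul_mul_assoc, ← smul_sub, smul_smul, inv_mul_cancel₀ hb, one_smul]
      ring
  · refine ⟨a⁻¹ • y, le_antisymm ?_ ?_, ?_⟩
    · rw [Submodule.span_le, Set.pair_subset_iff]
      refine ⟨Submodule.mem_span_pair.2 ⟨a⁻¹, -b, ?_⟩, Submodule.mem_span_pair.2 ⟨0, a, ?_⟩⟩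
      · simp [smul_smul, ha, mul_comm]
      · simp [smul_smul, ha]
    · rw [Submodule.span_le, Set.pair_subset_iff]
      refine ⟨h, Submodule.mem_span_pair.2 ⟨0, a⁻¹, ?_⟩⟩
      simp
    · rw [map_smul, mooreDet_apply, mooreDet_apply, hadd, hpow, hpow]
      have : (a • x + b • y) * y ^ Fintype.card F -
          (a • x ^ Fintype.card F + b • y ^ Fintype.card F) * y =
          a • (x * y ^ Fintype.card F - x ^ Fintype.card F * y) := by
        simp only [add_mul, smul_mul_assoc, smul_sub]
        rw [← pow_succ, ← pow_succ']
        ring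
      rw [this, smul_smul, inv_mul_cancel₀ ha, one_smul]

/-- Two-dimensional subspaces of `K` can be coloured by the elements of `L` in such a way that
distinct subspaces of the same colour intersect trivially: a subspace is coloured by the Moore
determinant of a basis. -/
theorem exists_planeColouring [Finite K] {L : Type*} [AddCommGroup L] [Module F L]
    [FiniteDimensional F L] (hKL : finrank F K ≤ finrank F L) :
    ∃ t : {C : Submodule F K // finrank F C = 2} → L,
      ∀ C C', t C = t C' → C ≠ C' → C.1 ⊓ C'.1 = ⊥ := by
  obtain ⟨j, hj⟩ := finrank_le_iff_exists_linearMap.1 hKL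
  choose x y hxy using fun C : {C : Submodule F K // finrank F C = 2} => exists_span_pair_eq C.2
  refine ⟨fun C => j (mooreDet F K (x C) (y C)), fun C C' ht hne => ?_⟩
  rw [Submodule.eq_bot_iff]
  rintro z ⟨hz, hz'⟩
  by_contra hz0
  refine hne (Subtype.ext ?_)
  have hz : z ∈ C.1 := hz
  have hz' : z ∈ C'.1 := hz'
  rw [hxy C] at hz
  rw [hxy C'] at hz'
  obtain ⟨w, hw, hδ⟩ := exists_span_pair_eq_and_mooreDet_eq hz0 hz
  obtain ⟨w', hw', hδ'⟩ := exists_span_pair_eq_and_mooreDet_eq hz0 hz'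
  have h0 : mooreDet F K z (w - w') = 0 := by
    rw [map_sub, hδ, hδ', hj ht, sub_self]
  obtain ⟨c, hc⟩ := Submodule.mem_span_singleton.1 (mem_span_singleton_of_mooreDet_eq_zero hz0 h0)
  rw [hxy C, hxy C', hw, hw']
  refine le_antisymm ?_ ?_ <;> rw [Submodule.span_le, Set.pair_subset_iff]
  · refine ⟨Submodule.mem_span_pair.2 ⟨1, 0, by simp⟩, Submodule.mem_span_pair.2 ⟨c, 1, ?_⟩⟩
    rw [hc]; simp
  · refine ⟨Submodule.mem_span_pair.2 ⟨1, 0, by simp⟩, Submodule.mem_span_pair.2 ⟨-c, 1, ?_⟩⟩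
    rw [neg_smul, hc]; simp

end FiniteFieldExtension

section Counting

variable {F E : Type*} [Field F] [Fintype F] [AddCommGroup E] [Module F E] [Finite E]

theorem card_planes_mul (h : 2 ≤ finrank F E) :
    Nat.card {C : Submodule F E // finrank F C = 2} *
        ((Fintype.card F ^ 2 - 1) * (Fintype.card F ^ 2 - Fintype.card F)) =
      (Fintype.card F ^ finrank F E - 1) * (Fintype.card F ^ finrank F E - Fintype.card F) := by
  let f : {s : Fin 2 → E // LinearIndependent F s} → {C : Submodule F E // finrank F C = 2} :=
    fun s => ⟨Submodule.span F (Set.range s.1), by simpa using finrank_span_eq_card s.2⟩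
  let e (C : {C : Submodule F E // finrank F C = 2}) :
      {s // f s = C} ≃ {s : Fin 2 → C.1 // LinearIndependent F s} :=
    { toFun s := ⟨fun i => ⟨s.1.1 i, by
          rw [← congrArg Subtype.val s.2]
          exact Submodule.subset_span ⟨i, rfl⟩⟩,
        LinearIndependent.of_comp C.1.subtype s.1.2⟩
      invFun s := ⟨⟨fun i => (s.1 i : E), s.2.map' C.1.subtype C.1.ker_subtype⟩, by
        refine Subtype.ext (Submodule.eq_of_le_of_finrank_eq ?_ ?_)
        · rw [Submodule.span_le]
          rintro _ ⟨i, rfl⟩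
          exact (s.1 i).2
        · rw [C.2]
          exact (f _).2⟩
      left_inv s := rfl
      right_inv s := rfl }
  have hfib (C : {C : Submodule F E // finrank F C = 2}) :
      Nat.card {s // f s = C} =
        (Fintype.card F ^ 2 - 1) * (Fintype.card F ^ 2 - Fintype.card F) := by
    rw [Nat.card_congr (e C), card_linearIndependent C.2.ge, C.2]
    simp [Fin.prod_univ_two]
  have htot := card_linearIndependent (K := F) (V := E) h
  have := Fintype.ofFinite {C : Submodule F E // finrank F C = 2}
  rw [← Nat.card_congr (Equiv.sigmaFiberEquiv f), Nat.card_sigma] at htot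
  simp only [hfib, Fin.prod_univ_two] at htot
  simpa [Nat.card_eq_fintype_card] using htot

theorem card_planes_of_finrank_eq_five (h : finrank F E = 5) :
    Nat.card {C : Submodule F E // finrank F C = 2} =
      Fintype.card F ^ 6 + Fintype.card F ^ 5 + 2 * Fintype.card F ^ 4 + 2 * Fintype.card F ^ 3 +
        2 * Fintype.card F ^ 2 + Fintype.card F + 1 := by
  have hmul := card_planes_mul (F := F) (E := E) (by omega)
  have hq : 1 < Fintype.card F := Fintype.one_lt_card
  rw [h] at hmul
  generalize Fintype.card F = q at *
  have h2 : q < q ^ 2 := by nlinarith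
  have h5 : q < q ^ 5 := h2.trans (Nat.pow_lt_pow_right hq (by norm_num))
  refine Nat.eq_of_mul_eq_mul_right (m := (q ^ 2 - 1) * (q ^ 2 - q)) ?_ (hmul.trans ?_)
  · exact Nat.mul_pos (by omega) (by omega)
  · zify [h2.le, h5.le, (hq.trans h2).le, (hq.trans h5).le]
    ring

theorem additional_le {q : ℕ} (hq : 2 ≤ q) :
    q ^ 15 + 2 * q ^ 13 + 3 * q ^ 12 + 5 * q ^ 11 + q ^ 10 + 3 * q ^ 9 + 6 * q ^ 8 + 7 * q ^ 7 +
        5 * q ^ 6 + 3 * q ^ 5 + 3 * q ^ 4 + q ^ 3 + 1 ≤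
      q ^ 6 * ((q ^ 6 + q ^ 5 + 2 * q ^ 4 + 2 * q ^ 3 + 2 * q ^ 2 + q + 1) * q ^ 3) := by
  obtain ⟨r, rfl⟩ := Nat.exists_eq_add_of_le hq
  zify
  rw [← sub_nonneg]
  ring_nf
  positivity

end Counting

section Construction

variable {F B E K : Type*} [Field F] [AddCommGroup B] [Module F B] [AddCommGroup E] [Module F E]
  [AddCommGroup K] [Module F K]

/-- The graph of the restriction of `φ` to `U`, as a subspace of `B × E`. -/
def graphOn (U : Submodule F B) (φ : B →ₗ[F] E) : Submodule F (B × E) :=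
  U.map (LinearMap.prod LinearMap.id φ)

theorem mem_graphOn {U : Submodule F B} {φ : B →ₗ[F] E} {v : B × E} :
    v ∈ graphOn U φ ↔ v.1 ∈ U ∧ v.2 = φ v.1 := by
  constructor
  · rintro ⟨u, hu, rfl⟩
    exact ⟨hu, rfl⟩
  · rintro ⟨hu, hv⟩
    exact ⟨v.1, hu, Prod.ext rfl hv.symm⟩

theorem finrank_graphOn (U : Submodule F B) (φ : B →ₗ[F] E) :
    finrank F (graphOn U φ) = finrank F U :=
  (U.equivMapOfInjective _ fun _ _ h => congrArg Prod.fst h).finrank_eq.symm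

theorem graphOn_inf_graphOn (U U' : Submodule F B) (φ φ' : B →ₗ[F] E) :
    graphOn U φ ⊓ graphOn U' φ' = graphOn (U ⊓ U' ⊓ LinearMap.ker (φ - φ')) φ := by
  ext v
  simp only [Submodule.mem_inf, mem_graphOn, LinearMap.mem_ker, LinearMap.sub_apply, sub_eq_zero]
  constructor
  · rintro ⟨⟨h1, h2⟩, h3, h4⟩
    exact ⟨⟨⟨h1, h3⟩, h2.symm.trans h4⟩, h2⟩
  · rintro ⟨⟨⟨h1, h3⟩, h4⟩, h2⟩
    exact ⟨⟨h1, h2⟩, h3, h2.trans h4⟩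

/-- The subspace of all `((x, β x), γ x + c)` with `c` in `C`. -/
def thickenedGraph {P : Type*} [AddCommGroup P] [Module F P] (β : P →ₗ[F] K) (γ : P →ₗ[F] E)
    (C : Submodule F E) : Submodule F ((P × K) × E) :=
  LinearMap.range (((LinearMap.prod LinearMap.id β) ∘ₗ LinearMap.fst F P C).prod
    (γ ∘ₗ LinearMap.fst F P C + C.subtype ∘ₗ LinearMap.snd F P C))

variable {P : Type*} [AddCommGroup P] [Module F P]

theorem mem_thickenedGraph {β : P →ₗ[F] K} {γ : P →ₗ[F] E} {C : Submodule F E}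
    {v : (P × K) × E} :
    v ∈ thickenedGraph β γ C ↔ v.1.2 = β v.1.1 ∧ v.2 - γ v.1.1 ∈ C := by
  constructor
  · rintro ⟨⟨x, c⟩, rfl⟩
    exact ⟨rfl, by simp⟩
  · rintro ⟨h1, h2⟩
    refine ⟨(v.1.1, ⟨v.2 - γ v.1.1, h2⟩), ?_⟩
    refine Prod.ext (Prod.ext rfl h1.symm) ?_
    simp

theorem finrank_thickenedGraph [FiniteDimensional F P] [FiniteDimensional F E] (β : P →ₗ[F] K)
    (γ : P →ₗ[F] E) (C : Submodule F E) :
    finrank F (thickenedGraph β γ C) = finrank F P + finrank F C := by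
  rw [thickenedGraph, LinearMap.finrank_range_of_inj, Module.finrank_prod]
  rintro ⟨x, c⟩ ⟨y, d⟩ h
  obtain rfl : x = y := congrArg (fun v => v.1.1) h
  have h2 : γ x + c = γ x + d := congrArg Prod.snd h
  exact Prod.ext rfl (Subtype.ext (add_left_cancel h2))

theorem finrank_thickenedGraph_inf_le [FiniteDimensional F P] [FiniteDimensional F K]
    [FiniteDimensional F E] (β β' : P →ₗ[F] K) (γ γ' : P →ₗ[F] E) (C C' : Submodule F E)
    {D : Submodule F P}
    (hD : ∀ x, β x = β' x → γ x - γ' x ∈ C ⊔ C' → x ∈ D) :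
    finrank F ↥(thickenedGraph β γ C ⊓ thickenedGraph β' γ' C') ≤
      finrank F D + finrank F ↥(C ⊓ C') := by
  refine (finrank_le_finrank_map_add_finrank_inf_ker _
    (LinearMap.fst F P K ∘ₗ LinearMap.fst F (P × K) E)).trans (add_le_add ?_ ?_)
  · refine Submodule.finrank_mono ?_
    rintro _ ⟨v, ⟨hv, hv'⟩, rfl⟩
    obtain ⟨h1, h2⟩ := mem_thickenedGraph.1 hv
    obtain ⟨h1', h2'⟩ := mem_thickenedGraph.1 hv'
    refine hD _ (h1.symm.trans h1') ?_
    have := Submodule.add_mem _ (Submodule.mem_sup_left (T := C') (Submodule.neg_mem _ h2))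
      (Submodule.mem_sup_right (S := C) h2')
    convert this using 1
    simp
  · refine (Submodule.finrank_mono ?_).trans
      (Submodule.finrank_map_le (LinearMap.inr F (P × K) E) (C ⊓ C'))
    rintro ⟨⟨x, k⟩, e⟩ ⟨⟨hv, hv'⟩, hx⟩
    obtain rfl : x = 0 := hx
    obtain ⟨h1, h2⟩ := mem_thickenedGraph.1 hv
    obtain ⟨-, h2'⟩ := mem_thickenedGraph.1 hv'
    obtain rfl : k = 0 := by simpa using h1
    exact ⟨e, ⟨by simpa using h2, by simpa using h2'⟩, rfl⟩

theorem finrank_graphOn_inf_thickenedGraph_le [FiniteDimensional F P] [FiniteDimensional F K]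
    [FiniteDimensional F E] (U : Submodule F (P × K)) (φ : P × K →ₗ[F] E) (β : P →ₗ[F] K)
    (γ : P →ₗ[F] E) (C : Submodule F E) :
    finrank F ↥(graphOn U φ ⊓ thickenedGraph β γ C) ≤ finrank F P := by
  refine (finrank_le_finrank_map_add_finrank_inf_ker _
    (LinearMap.fst F P K ∘ₗ LinearMap.fst F (P × K) E)).trans ?_
  have hker : (graphOn U φ ⊓ thickenedGraph β γ C) ⊓
      LinearMap.ker (LinearMap.fst F P K ∘ₗ LinearMap.fst F (P × K) E) = ⊥ := by
    rw [Submodule.eq_bot_iff]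
    rintro ⟨⟨x, k⟩, e⟩ ⟨⟨hv, hv'⟩, hx⟩
    have hx : x = 0 := hx
    have h1 : k = β x := (mem_thickenedGraph.1 hv').1
    have h2 : e = φ (x, k) := (mem_graphOn.1 hv).2
    subst hx
    rw [map_zero] at h1
    subst h1
    rw [h2, ← Prod.zero_eq_mk, map_zero]
    rfl
  rw [hker, finrank_bot, add_zero]
  exact Submodule.finrank_le _

end Construction

section Codes

variable {F V W : Type*} [Field F] [AddCommGroup V] [Module F V] [AddCommGroup W] [Module F W]

/-- There are `N` four-dimensional subspaces of `V` at pairwise subspace distance at least `4`. -/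
def HasCode (F V : Type*) [Field F] [AddCommGroup V] [Module F V] (N : ℕ) : Prop :=
  ∃ S : Set (Submodule F V), S.ncard = N ∧
    (∀ X ∈ S, finrank F ↥X = 4) ∧ ∀ X ∈ S, ∀ Y ∈ S, X ≠ Y → 4 ≤ subspaceDist X Y

theorem HasCode.congr (e : V ≃ₗ[F] W) {N : ℕ} (h : HasCode F V N) : HasCode F W N := by
  obtain ⟨S, hS, hdim, hdist⟩ := h
  refine ⟨Submodule.map e.toLinearMap '' S, ?_, ?_, ?_⟩
  · rw [Set.ncard_image_of_injective _ (Submodule.map_injective_of_injective e.injective), hS]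
  · rintro _ ⟨X, hX, rfl⟩
    rw [LinearEquiv.finrank_map_eq, hdim X hX]
  · rintro _ ⟨X, hX, rfl⟩ _ ⟨Y, hY, rfl⟩ hne
    have := hdist X hX Y hY fun h => hne (h ▸ rfl)
    rwa [subspaceDist, ← Submodule.map_sup, LinearEquiv.finrank_map_eq, LinearEquiv.finrank_map_eq,
      LinearEquiv.finrank_map_eq]

theorem hasCode_of_family [FiniteDimensional F V] {ι : Type*} [Finite ι] (f : ι → Submodule F V)
    (hdim : ∀ i, finrank F (f i) = 4) (hinf : ∀ i j, i ≠ j → finrank F ↥(f i ⊓ f j) ≤ 2) {N : ℕ}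
    (hN : N ≤ Nat.card ι) : HasCode F V N := by
  have hinj : Function.Injective f := by
    intro i j hij
    by_contra hne
    have := hinf i j hne
    rw [hij, inf_idem, hdim] at this
    omega
  have hcard : N ≤ (Set.range f).ncard := by
    rwa [← Set.image_univ, Set.ncard_image_of_injective _ hinj, Set.ncard_univ]
  obtain ⟨S, hS, hSN⟩ := Set.exists_subset_card_eq hcard
  refine ⟨S, hSN, fun X hX => ?_, fun X hX Y hY hne => ?_⟩
  · obtain ⟨i, rfl⟩ := hS hX
    exact hdim i
  · obtain ⟨i, rfl⟩ := hS hX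
    obtain ⟨j, rfl⟩ := hS hY
    exact (four_le_subspaceDist_iff (hdim i) (hdim j)).2 (hinf i j fun h => hne (h ▸ rfl))

theorem exists_linearMap_inf_ker_eq_bot [FiniteDimensional F V] [FiniteDimensional F W]
    (U : Submodule F V) (h : finrank F U ≤ finrank F W) :
    ∃ g : V →ₗ[F] W, U ⊓ LinearMap.ker g = ⊥ := by
  obtain ⟨j, hj⟩ := finrank_le_iff_exists_linearMap.1 h
  obtain ⟨g, hg⟩ := LinearMap.exists_extend j
  refine ⟨g, (Submodule.eq_bot_iff _).2 ?_⟩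
  rintro x ⟨hx, hgx⟩
  have h0 : j ⟨x, hx⟩ = j 0 := by
    rw [← hg, map_zero]
    exact hgx
  exact congrArg Subtype.val (hj h0)

end Codes

theorem finrank_graphOn_linearizedMap_inf_le {F B E : Type*} [Field F] [Fintype F] [AddCommGroup B]
    [Module F B] [FiniteDimensional F B] [Field E] [Algebra F E] [Finite E] (U : Submodule F B)
    {g : B →ₗ[F] E} (hg : U ⊓ LinearMap.ker g = ⊥) {k : ℕ} {a a' : Fin (k + 1) → E}
    (ha : a ≠ a') :
    finrank F ↥(graphOn U (linearizedMap F E a ∘ₗ g) ⊓ graphOn U (linearizedMap F E a' ∘ₗ g)) ≤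
      k := by
  rw [graphOn_inf_graphOn, finrank_graphOn, ← LinearMap.sub_comp, ← linearizedMap_sub, inf_idem]
  refine (finrank_le_finrank_map_add_finrank_inf_ker _ g).trans ?_
  have hbot : (U ⊓ LinearMap.ker (linearizedMap F E (a - a') ∘ₗ g)) ⊓ LinearMap.ker g = ⊥ := by
    rw [inf_right_comm, hg, bot_inf_eq]
  rw [hbot, finrank_bot, add_zero]
  refine le_trans (Submodule.finrank_mono ?_) (finrank_ker_linearizedMap_le (sub_ne_zero.2 ha))
  rintro _ ⟨x, ⟨-, hx⟩, rfl⟩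
  exact hx

theorem hasCode_prod {F K E L : Type*} [Field F] [Fintype F] [Field K] [Algebra F K] [Finite K]
    [Field E] [Algebra F E] [Finite E] [Field L] [Algebra F L] [Finite L]
    (hK : finrank F K = 6) (hE : finrank F E = 5) (hL : finrank F L = 3) {N M : ℕ}
    (h : HasCode F ((F × F) × K) N)
    (hM : M ≤ Nat.card (Fin 3 → E) * N +
      Nat.card (K × {C : Submodule F E // finrank F C = 2} × L)) :
    HasCode F (((F × F) × K) × E) M := by
  obtain ⟨S, hS, hdim, hdist⟩ := h
  have hSE (U : S) : finrank F U.1 ≤ finrank F E := by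
    rw [hdim _ U.2, hE]; norm_num
  choose g hg using fun U : S => exists_linearMap_inf_ker_eq_bot (W := E) U.1 (hSE U)
  obtain ⟨α, hα, hα0⟩ := exists_pencil (F := F) (K := K) (by omega)
  obtain ⟨t, ht⟩ := exists_planeColouring (F := F) (K := E) (L := K) (by omega)
  choose ψ hψ using fun C : {C : Submodule F E // finrank F C = 2} =>
    exists_pencil_transverse (F := F) (K := L) (by omega) C.1 (by rw [C.2, hL, hE])
  have hFF : finrank F (F × F) = 2 := by simp
  let X₁ (i : (Fin 3 → E) × S) := graphOn i.2.1 (linearizedMap F E i.1 ∘ₗ g i.2)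
  let X₂ (i : K × {C : Submodule F E // finrank F C = 2} × L) :=
    thickenedGraph (α (i.1, t i.2.1)) (ψ i.2.1 i.2.2) i.2.1.1
  have h₁ (i j) (hij : i ≠ j) : finrank F ↥(X₁ i ⊓ X₁ j) ≤ 2 := by
    obtain ⟨a, U⟩ := i
    obtain ⟨a', U'⟩ := j
    rcases eq_or_ne U U' with rfl | hU
    · exact finrank_graphOn_linearizedMap_inf_le U.1 (hg U) fun h => hij (Prod.ext h rfl)
    · have hne : U.1 ≠ U'.1 := fun h => hU (Subtype.ext h)
      have := (four_le_subspaceDist_iff (hdim _ U.2) (hdim _ U'.2)).1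
        (hdist _ U.2 _ U'.2 hne)
      change finrank F ↥(graphOn U.1 _ ⊓ graphOn U'.1 _) ≤ 2
      rw [graphOn_inf_graphOn, finrank_graphOn]
      exact (Submodule.finrank_mono inf_le_left).trans this
  have h₂ (i j) (hij : i ≠ j) : finrank F ↥(X₂ i ⊓ X₂ j) ≤ 2 := by
    obtain ⟨m, C, c⟩ := i
    obtain ⟨m', C', c'⟩ := j
    rcases eq_or_ne C C' with rfl | hC
    · refine (finrank_thickenedGraph_inf_le _ _ _ _ _ _ (D := ⊥) fun x hβ hγ => ?_).trans ?_
      · rw [sup_idem] at hγ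
        simp only at hβ hγ
        rcases eq_or_ne m m' with rfl | hm
        · refine hψ C (c - c') x (sub_ne_zero.2 fun h => hij (h ▸ rfl)) ?_
          rwa [map_sub]
        · refine hα0 (m - m') x (sub_ne_zero.2 hm) ?_
          have : ((m - m', 0) : K × K) = (m, t C) - (m', t C) := by simp
          rw [this, map_sub, LinearMap.sub_apply, hβ, sub_self]
      · rw [finrank_bot, zero_add, inf_idem, C.2]
    · have hCne : C.1 ≠ C'.1 := fun h => hC (Subtype.ext h)
      refine (finrank_thickenedGraph_inf_le _ _ _ _ _ _
        (D := LinearMap.ker (α (m, t C) - α (m', t C'))) fun x hβ _ => ?_).trans ?_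
      · rw [LinearMap.mem_ker, LinearMap.sub_apply, hβ, sub_self]
      · rcases eq_or_ne (t C) (t C') with htC | htC
        · change _ + finrank F ↥(C.1 ⊓ C'.1) ≤ 2
          rw [ht C C' htC hC, finrank_bot, add_zero]
          exact (Submodule.finrank_le _).trans hFF.le
        · have hker : LinearMap.ker (α (m, t C) - α (m', t C')) ≠ ⊤ := by
            refine fun h => hα ((m, t C) - (m', t C')) ?_ ?_
            · exact sub_ne_zero.2 fun h => htC (congrArg Prod.snd h)
            · rw [map_sub]
              exact LinearMap.ker_eq_top.1 h
          have hlt := Submodule.finrank_lt hker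
          have hlt' := finrank_inf_lt_of_ne (C.2.trans C'.2.symm) hCne
          rw [C.2] at hlt'
          rw [hFF] at hlt
          simp only
          omega
  have h₁₂ (i j) : finrank F ↥(X₁ i ⊓ X₂ j) ≤ 2 :=
    (finrank_graphOn_inf_thickenedGraph_le _ _ _ _ _).trans hFF.le
  refine hasCode_of_family (Sum.elim X₁ X₂) ?_ ?_ ?_
  · rintro (i | i)
    · exact (finrank_graphOn _ _).trans (hdim _ i.2.2)
    · exact (finrank_thickenedGraph _ _ _).trans (by rw [hFF, i.2.1.2])
  · rintro (i | i) (j | j) hij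
    · exact h₁ i j fun h => hij (h ▸ rfl)
    · exact h₁₂ i j
    · rw [inf_comm]
      exact h₁₂ j i
    · exact h₂ i j fun h => hij (h ▸ rfl)
  · rw [Nat.card_sum, Nat.card_prod (Fin 3 → E) S]
    rwa [← hS] at hM

theorem statement10 (q N : ℕ) (hq : IsPrimePow q)
    (F : Type) [Field F] [Fintype F] (hcard : Fintype.card F = q)
    (h : ∃ S : Set (Submodule F (Fin 8 → F)), S.ncard = N ∧
      (∀ X ∈ S, Module.finrank F ↥X = 4) ∧
      (∀ X ∈ S, ∀ Y ∈ S, X ≠ Y → 4 ≤ subspaceDist X Y)) :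
    ∃ S : Set (Submodule F (Fin 13 → F)),
      S.ncard = N * q ^ 15 + (q ^ 15 + 2 * q ^ 13 + 3 * q ^ 12 + 5 * q ^ 11 + q ^ 10 + 3 * q ^ 9 + 6 * q ^ 8 + 7 * q ^ 7 + 5 * q ^ 6 + 3 * q ^ 5 + 3 * q ^ 4 + q ^ 3 + 1) ∧
      (∀ X ∈ S, Module.finrank F ↥X = 4) ∧
      (∀ X ∈ S, ∀ Y ∈ S, X ≠ Y → 4 ≤ subspaceDist X Y) := by
  obtain ⟨K, _, _, _, hK⟩ := exists_fieldExtension F 6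
  obtain ⟨E, _, _, _, hE⟩ := exists_fieldExtension F 5
  obtain ⟨L, _, _, _, hL⟩ := exists_fieldExtension F 3
  have hB : finrank F (Fin 8 → F) = finrank F ((F × F) × K) := by simp [hK]
  have hV : finrank F (((F × F) × K) × E) = finrank F (Fin 13 → F) := by simp [hK, hE]
  have hcode : HasCode F (Fin 8 → F) N := h
  refine HasCode.congr (LinearEquiv.ofFinrankEq _ _ hV)
    (hasCode_prod hK hE hL (hcode.congr (LinearEquiv.ofFinrankEq _ _ hB)) ?_)
  have hcardF (M : Type) [AddCommGroup M] [Module F M] [Finite M] :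
      Nat.card M = q ^ finrank F M := by
    rw [Module.natCard_eq_pow_finrank (K := F), Nat.card_eq_fintype_card, hcard]
  rw [Nat.card_prod, Nat.card_prod, card_planes_of_finrank_eq_five hE, Nat.card_fun, hcardF K,
    hcardF E, hcardF L, hK, hE, hL, hcard]
  have := additional_le hq.two_le
  rw [Nat.card_eq_fintype_card, Fintype.card_fin, ← pow_mul, mul_comm N]
  exact Nat.add_le_add_left this _
end

section
/- There exists a set of 157396313 four-dimensional subspaces of F_2^{13} whose pairwise subspace distance is at least 4; that is, A_2(13,4,4) ≥ 157396313. -/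
open Module

namespace SubspaceCode

section General

variable {F X Y V V' : Type*} [Field F]
  [AddCommGroup X] [Module F X] [AddCommGroup Y] [Module F Y]
  [AddCommGroup V] [Module F V] [AddCommGroup V'] [Module F V']

/-- The dimension of a subspace of a product is bounded by the dimensions of any space containing
its first projection and any space containing its fibre over `0`. -/
lemma finrank_le_of_fst_of_fiber [FiniteDimensional F V] [FiniteDimensional F V']
    {Z : Submodule F (V × V')} {I : Submodule F V} {J : Submodule F V'}
    (hI : ∀ z ∈ Z, z.1 ∈ I) (hJ : ∀ v, ((0 : V), v) ∈ Z → v ∈ J) :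
    finrank F Z ≤ finrank F I + finrank F J := by
  set f : Z →ₗ[F] V := (LinearMap.fst F V V').domRestrict Z
  have hrange : LinearMap.range f ≤ I := by
    rintro _ ⟨z, rfl⟩
    exact hI z z.2
  have hker : finrank F (LinearMap.ker f) ≤ finrank F J := by
    have hz (z : LinearMap.ker f) : z.1.1.1 = 0 := z.2
    let g : LinearMap.ker f →ₗ[F] V' :=
      LinearMap.snd F V V' ∘ₗ Z.subtype ∘ₗ (LinearMap.ker f).subtype
    have hg (z : LinearMap.ker f) : g z ∈ J := by
      refine hJ _ ?_
      have h : ((0 : V), z.1.1.2) = z.1.1 := Prod.ext (hz z).symm rfl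
      change ((0 : V), z.1.1.2) ∈ Z
      rw [h]
      exact z.1.2
    refine LinearMap.finrank_le_finrank_of_injective (f := g.codRestrict J hg) fun z w h => ?_
    have h' : z.1.1.2 = w.1.1.2 := congrArg Subtype.val h
    exact Subtype.ext (Subtype.ext (Prod.ext ((hz z).trans (hz w).symm) h'))
  have := f.finrank_range_add_finrank_ker
  have := Submodule.finrank_mono hrange
  omega

/-- A family of four-dimensional subspaces whose distinct members meet in dimension at most two. -/
def IsCode {ι : Type*} (W : ι → Submodule F V) : Prop :=
  (∀ i, finrank F (W i) = 4) ∧ ∀ i j, i ≠ j → finrank F ↥(W i ⊓ W j) ≤ 2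

lemma IsCode.sumElim {ι κ : Type*} {W : ι → Submodule F V} {W' : κ → Submodule F V}
    (h : IsCode W) (h' : IsCode W') (hc : ∀ i j, finrank F ↥(W i ⊓ W' j) ≤ 2) :
    IsCode (Sum.elim W W') := by
  refine ⟨?_, ?_⟩
  · rintro (i | i)
    exacts [h.1 i, h'.1 i]
  · rintro (i | i) (j | j) hij
    · exact h.2 i j fun e => hij (e ▸ rfl)
    · exact hc i j
    · exact inf_comm (W j) (W' i) ▸ hc j i
    · exact h'.2 i j fun e => hij (e ▸ rfl)

lemma IsCode.map {ι : Type*} {W : ι → Submodule F V} (h : IsCode W) (e : V ≃ₗ[F] V') :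
    IsCode fun i => (W i).map (e : V →ₗ[F] V') := by
  refine ⟨fun i => (e.finrank_map_eq (W i)).trans (h.1 i), fun i j hij => ?_⟩
  rw [← Submodule.map_inf _ e.injective]
  exact (e.finrank_map_eq (W i ⊓ W j)).trans_le (h.2 i j hij)

lemma IsCode.injective [FiniteDimensional F V] {ι : Type*} {W : ι → Submodule F V}
    (h : IsCode W) : Function.Injective W := by
  intro i j hij
  by_contra hne
  have h1 := h.2 i j hne
  rw [← hij, inf_idem, h.1 i] at h1
  omega

lemma IsCode.exists_set [FiniteDimensional F V] {ι : Type*} [Finite ι]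
    {W : ι → Submodule F V} (h : IsCode W) {N : ℕ} (hN : N ≤ Nat.card ι) :
    ∃ S : Set (Submodule F V), S.ncard = N ∧ (∀ X ∈ S, finrank F ↥X = 4) ∧
      ∀ X ∈ S, ∀ Y ∈ S, X ≠ Y → 4 ≤ subspaceDist X Y := by
  have hcard : N ≤ (Set.range W).ncard := by
    rwa [← Set.image_univ, Set.ncard_image_of_injective _ h.injective, Set.ncard_univ]
  obtain ⟨S, hS, rfl⟩ := Set.exists_subset_card_eq hcard
  refine ⟨S, rfl, fun X hX => ?_, fun X hX Y hY hXY => ?_⟩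
  · obtain ⟨i, rfl⟩ := hS hX
    exact h.1 i
  · obtain ⟨i, rfl⟩ := hS hX
    obtain ⟨j, rfl⟩ := hS hY
    have h1 := h.2 i j fun e => hXY (e ▸ rfl)
    have h2 := Submodule.finrank_sup_add_finrank_inf_eq (W i) (W j)
    have h3 := h.1 i
    have h4 := h.1 j
    unfold subspaceDist
    omega

/-- Every nonzero element of `D` has rank at least two. -/
def IsRankTwoCode (D : Submodule F (X →ₗ[F] Y)) : Prop :=
  ∀ M ∈ D, M ≠ 0 → finrank F (LinearMap.ker M) + 2 ≤ finrank F X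

lemma finrank_range_prod_inf_le [FiniteDimensional F X]
    (u : X →ₗ[F] V) (hu : Function.Injective u) (M M' : X →ₗ[F] V') :
    finrank F ↥(LinearMap.range (u.prod M) ⊓ LinearMap.range (u.prod M')) ≤
      finrank F (LinearMap.ker (M - M')) := by
  refine le_trans (Submodule.finrank_mono ?_)
    (Submodule.finrank_map_le (u.prod M) (LinearMap.ker (M - M')))
  rintro _ ⟨⟨x, rfl⟩, ⟨y, hy⟩⟩
  obtain rfl : y = x := hu (congrArg Prod.fst hy)
  refine ⟨y, ?_, rfl⟩
  have h : M' y = M y := congrArg Prod.snd hy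
  simp [h]

/-- If `Z` projects into `T`, then the graph-like subspace `range (u.prod M)` meets `Z` in dimension
at most that of `range u ⊓ T`. -/
lemma finrank_range_prod_inf_le_of_mem [FiniteDimensional F V] [FiniteDimensional F V']
    {u : X →ₗ[F] V} (hu : Function.Injective u) (M : X →ₗ[F] V') (Z : Submodule F (V × V'))
    {T : Submodule F V} (hT : ∀ z ∈ Z, z.1 ∈ T) :
    finrank F ↥(LinearMap.range (u.prod M) ⊓ Z) ≤ finrank F ↥(LinearMap.range u ⊓ T) := by
  refine le_trans (finrank_le_of_fst_of_fiber (I := LinearMap.range u ⊓ T) (J := ⊥) ?_ ?_) (by simp)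
  · rintro _ ⟨⟨x, rfl⟩, h⟩
    exact ⟨⟨x, rfl⟩, hT _ h⟩
  · rintro v ⟨⟨x, hx⟩, -⟩
    have h0 : u x = 0 := congrArg Prod.fst hx
    have h1 : M x = v := congrArg Prod.snd hx
    rw [(map_eq_zero_iff u hu).1 h0, map_zero] at h1
    exact h1.symm

/-- Lifting a code by a rank-metric code of minimum distance two. -/
lemma isCode_lift [FiniteDimensional F X] [FiniteDimensional F V] [FiniteDimensional F V']
    (hX : finrank F X = 4)
    {ι : Type*} {u : ι → X →ₗ[F] V} (hu : ∀ i, Function.Injective (u i))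
    (huv : ∀ i j, i ≠ j → finrank F ↥(LinearMap.range (u i) ⊓ LinearMap.range (u j)) ≤ 2)
    {D : Submodule F (X →ₗ[F] V')} (hD : IsRankTwoCode D) :
    IsCode fun a : ι × D => LinearMap.range ((u a.1).prod (a.2 : X →ₗ[F] V')) := by
  refine ⟨?_, ?_⟩
  · rintro ⟨i, M⟩
    rw [LinearMap.finrank_range_of_inj, hX]
    exact fun x y h => hu i (congrArg Prod.fst h)
  · rintro ⟨i, M⟩ ⟨j, M'⟩ hne
    by_cases hij : i = j
    · subst hij
      have h1 := hD (M - M' : X →ₗ[F] V') (D.sub_mem M.2 M'.2) fun h =>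
        hne (Prod.ext rfl (Subtype.ext (sub_eq_zero.1 h)))
      have h2 := finrank_range_prod_inf_le (u i) (hu i) (M : X →ₗ[F] V') M'
      dsimp only
      omega
    · refine (finrank_range_prod_inf_le_of_mem (hu i) _ _ (T := LinearMap.range (u j)) ?_).trans
        (huv i j hij)
      rintro _ ⟨x, rfl⟩
      exact ⟨x, rfl⟩

end General

/-- Existence of linear maximum rank distance codes of minimum distance two. -/
lemma exists_isRankTwoCode {p : ℕ} [Fact p.Prime] (X Y : Type*) [AddCommGroup X]
    [Module (ZMod p) X] [FiniteDimensional (ZMod p) X] [AddCommGroup Y] [Module (ZMod p) Y]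
    [FiniteDimensional (ZMod p) Y] (hX : 0 < finrank (ZMod p) X)
    (hXY : finrank (ZMod p) X ≤ finrank (ZMod p) Y) :
    ∃ D : Submodule (ZMod p) (X →ₗ[ZMod p] Y), IsRankTwoCode D ∧
      finrank (ZMod p) X * finrank (ZMod p) Y ≤ finrank (ZMod p) D + finrank (ZMod p) Y := by
  have hK : finrank (ZMod p) (GaloisField p (finrank (ZMod p) Y)) = finrank (ZMod p) Y :=
    GaloisField.finrank p (by omega)
  set K := GaloisField p (finrank (ZMod p) Y)
  let e : Y ≃ₗ[ZMod p] K := LinearEquiv.ofFinrankEq _ _ hK.symm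
  let b := finBasis (ZMod p) X
  let c := finBasis (ZMod p) K
  let α : Fin (finrank (ZMod p) X) → K := fun i => c (Fin.castLE (hXY.trans hK.ge) i)
  have hα : LinearIndependent (ZMod p) α :=
    c.linearIndependent.comp _ (Fin.castLE_injective _)
  let Φ : (X →ₗ[ZMod p] Y) →ₗ[ZMod p] K :=
    ∑ i, LinearMap.mulLeft (ZMod p) (α i) ∘ₗ e.toLinearMap ∘ₗ LinearMap.applyₗ (b i)
  have hΦ (M) : Φ M = ∑ i, α i * e (M (b i)) := by simp [Φ, LinearMap.sum_apply]
  refine ⟨LinearMap.ker Φ, ?_, ?_⟩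
  · intro M hM hM0
    by_contra hlt
    have hr := M.finrank_range_add_finrank_ker
    obtain ⟨y, hy⟩ := finrank_le_one_iff.1 (show finrank (ZMod p) (LinearMap.range M) ≤ 1 by omega)
    choose a ha using fun i => hy ⟨M (b i), LinearMap.mem_range_self M (b i)⟩
    replace ha (i) : M (b i) = a i • (y : Y) := (congrArg Subtype.val (ha i)).symm
    have h0 : (∑ i, a i • α i) * e y = 0 := by
      rw [LinearMap.mem_ker, hΦ] at hM
      rw [← hM, Finset.sum_mul]
      refine Finset.sum_congr rfl fun i _ => ?_
      rw [ha, map_smul, smul_mul_assoc, mul_smul_comm]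
    refine hM0 (b.ext fun i => ?_)
    rw [ha, LinearMap.zero_apply]
    rcases mul_eq_zero.1 h0 with h | h
    · rw [Fintype.linearIndependent_iff.1 hα a h i, zero_smul]
    · rw [(map_eq_zero_iff e e.injective).1 h, smul_zero]
  · have h1 := Φ.finrank_range_add_finrank_ker
    have h2 := (LinearMap.range Φ).finrank_le
    rw [finrank_linearMap] at h1
    rw [hK] at h2
    omega

/-- The field with two elements. -/
abbrev F := ZMod 2

/-- The plane over `F`. -/
abbrev Q := F × F

/-- The four-dimensional space over `F`. -/
abbrev B := Fin 4 → F

/-- The vector whose coordinates are the binary digits of `n`. -/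
def bits (n : ℕ) : B := fun i => if n.testBit i then 1 else 0

/-- Seven spreads of five lines each that partition the lines of `PG(3, 2)`; a line is given by two
of its points. -/
def packing : Fin 7 → Fin 5 → ℕ × ℕ :=
  ![![(1, 2), (4, 8), (5, 10), (6, 11), (7, 9)],
    ![(1, 4), (2, 8), (3, 13), (6, 9), (7, 11)],
    ![(1, 6), (2, 9), (3, 12), (4, 10), (5, 8)],
    ![(1, 8), (2, 12), (3, 5), (4, 11), (7, 10)],
    ![(1, 10), (2, 13), (3, 4), (5, 9), (6, 8)],
    ![(1, 12), (2, 4), (3, 9), (5, 11), (7, 8)],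
    ![(1, 14), (2, 5), (3, 8), (4, 9), (6, 10)]]

/-- A parametrization of the `j`-th line of the `i`-th spread. -/
def line (i : Fin 7) (j : Fin 5) : Q →ₗ[F] B where
  toFun x t := x.1 * bits (packing i j).1 t + x.2 * bits (packing i j).2 t
  map_add' x y := by ext t; simp; ring
  map_smul' a x := by ext t; simp; ring

lemma eq_zero_of_line_eq_line : ∀ i j k, j ≠ k → ∀ x y : Q,
    (∀ t, line i j x t = line i k y t) → x = 0 ∧ y = 0 := by
  decide +kernel

lemma eq_zero_of_line_eq_zero : ∀ i j, ∀ x : Q, (∀ t, line i j x t = 0) → x = 0 := by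
  decide +kernel

lemma exists_line_ne_line : ∀ i j i' j', (i, j) ≠ (i', j') →
    ∃ x : Q, ∀ y : Q, ∃ t, line i j x t ≠ line i' j' y t := by
  decide +kernel

/-- Multiplication of the field with four elements. -/
def mul : Q →ₗ[F] Q →ₗ[F] Q :=
  LinearMap.mk₂ F (fun s x => (s.1 * x.1 + s.2 * x.2, s.1 * x.2 + s.2 * x.1 + s.2 * x.2))
    (by decide +kernel) (by decide +kernel) (by decide +kernel) (by decide +kernel)

/-- The Frobenius map of the field with four elements. -/
def frob : Q →ₗ[F] Q where
  toFun x := (x.1 + x.2, x.2)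
  map_add' := by decide +kernel
  map_smul' := by decide +kernel

/-- The linearized polynomials `y x² + s x` over the field with four elements. -/
def linPoly (a : Q × Q) : Q →ₗ[F] Q := mul a.1 ∘ₗ frob + mul a.2

lemma eq_zero_of_mul_eq_zero : ∀ s x : Q, mul s x = 0 → s = 0 ∨ x = 0 := by
  decide +kernel

lemma eq_zero_of_linPoly_eq_zero : ∀ a : Q × Q, (∀ x, linPoly a x = 0) → a = 0 := by
  decide +kernel

/-- The first family of codewords in dimension eight: the graphs of linear maps. -/
def graphWord (M : B →ₗ[F] B) : B →ₗ[F] B × B := LinearMap.id.prod M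

/-- The second family of codewords in dimension eight: for lines `P`, `L` in the same spread, the
extensions of `L` by graphs of maps from `P` to a complement of `L`. -/
def pairWord (a : (Fin 7 × Fin 5 × Fin 5) × Q) : Q × Q →ₗ[F] B × B :=
  (LinearMap.prod (line a.1.1 a.1.2.1) (line a.1.1 (a.1.2.2 + 1) ∘ₗ mul a.2)).coprod
    (LinearMap.inr F B B ∘ₗ line a.1.1 a.1.2.2)

/-- Three-dimensional subspaces in dimension eight that are contained in no codeword of the first
two families. -/
def solidWord (a : Fin 5 × {y : Q // y ≠ 0} × Q) : Q × F →ₗ[F] B × B :=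
  (LinearMap.prod (line 0 a.1) (line 0 1 ∘ₗ linPoly (a.2.1, a.2.2))).coprod
    (LinearMap.inr F B B ∘ₗ line 0 0 ∘ₗ LinearMap.toSpanSingleton F Q a.2.1)

lemma line_injective (i : Fin 7) (j : Fin 5) : Function.Injective (line i j) :=
  (injective_iff_map_eq_zero _).2 fun x hx => eq_zero_of_line_eq_zero i j x (congrFun hx)

lemma line_eq_line {i : Fin 7} {j k : Fin 5} (h : j ≠ k) {x y : Q} (hxy : line i j x = line i k y) :
    x = 0 ∧ y = 0 :=
  eq_zero_of_line_eq_line i j k h x y (congrFun hxy)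

lemma finrank_range_line (i : Fin 7) (j : Fin 5) : finrank F (LinearMap.range (line i j)) = 2 := by
  rw [LinearMap.finrank_range_of_inj (line_injective i j)]
  simp

lemma range_line_inf_eq_bot {i : Fin 7} {j k : Fin 5} (h : j ≠ k) :
    LinearMap.range (line i j) ⊓ LinearMap.range (line i k) = ⊥ := by
  rw [eq_bot_iff]
  rintro _ ⟨⟨x, rfl⟩, ⟨y, hy⟩⟩
  simp [(line_eq_line h hy.symm).1]

lemma finrank_range_line_inf_le {i i' : Fin 7} {j j' : Fin 5} (h : (i, j) ≠ (i', j')) :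
    finrank F ↥(LinearMap.range (line i j) ⊓ LinearMap.range (line i' j')) ≤ 1 := by
  have hlt : LinearMap.range (line i j) ⊓ LinearMap.range (line i' j') <
      LinearMap.range (line i j) := by
    refine inf_lt_left.2 fun hle => ?_
    obtain ⟨x, hx⟩ := exists_line_ne_line i j i' j' h
    obtain ⟨y, hy⟩ := hle ⟨x, rfl⟩
    obtain ⟨t, ht⟩ := hx y
    exact ht (congrFun hy t).symm
  have := Submodule.finrank_lt_finrank_of_lt hlt
  rw [finrank_range_line] at this
  omega

lemma finrank_inf_le_two_left (i : Fin 7) (j : Fin 5) (Z : Submodule F B) :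
    finrank F ↥(LinearMap.range (line i j) ⊓ Z) ≤ 2 :=
  (Submodule.finrank_mono inf_le_left).trans (finrank_range_line i j).le

lemma graphWord_injective (M : B →ₗ[F] B) : Function.Injective (graphWord M) :=
  fun _ _ h => congrArg Prod.fst h

lemma pairWord_apply (i j k s x y) : pairWord ((i, j, k), s) (x, y) =
    (line i j x, line i (k + 1) (mul s x) + line i k y) := by
  simp [pairWord]

lemma solidWord_apply (j y s x c) : solidWord (j, y, s) (x, c) =
    (line 0 j x, line 0 1 (linPoly (y, s) x) + line 0 0 (c • (y : Q))) := by
  simp [solidWord]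

lemma pairWord_injective (a) : Function.Injective (pairWord a) := by
  obtain ⟨⟨i, j, k⟩, s⟩ := a
  refine (injective_iff_map_eq_zero _).2 ?_
  rintro ⟨x, y⟩ h
  rw [pairWord_apply, Prod.mk_eq_zero, map_eq_zero_iff _ (line_injective i j)] at h
  obtain ⟨rfl, h⟩ := h
  rw [map_zero, map_zero, zero_add, map_eq_zero_iff _ (line_injective i k)] at h
  rw [h, Prod.mk_zero_zero]

lemma solidWord_injective (a) : Function.Injective (solidWord a) := by
  obtain ⟨j, y, s⟩ := a
  refine (injective_iff_map_eq_zero _).2 ?_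
  rintro ⟨x, c⟩ h
  rw [solidWord_apply, Prod.mk_eq_zero, map_eq_zero_iff _ (line_injective 0 j)] at h
  obtain ⟨rfl, h⟩ := h
  rw [map_zero, map_zero, zero_add, map_eq_zero_iff _ (line_injective 0 0),
    smul_eq_zero_iff_left y.2] at h
  rw [h, Prod.mk_zero_zero]

lemma pairWord_fst_mem {i j k s} {z : B × B} (hz : z ∈ LinearMap.range (pairWord ((i, j, k), s))) :
    z.1 ∈ LinearMap.range (line i j) := by
  obtain ⟨⟨x, y⟩, rfl⟩ := hz
  rw [pairWord_apply]
  exact ⟨x, rfl⟩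

lemma pairWord_fiber {i j k s} {v : B}
    (hv : ((0 : B), v) ∈ LinearMap.range (pairWord ((i, j, k), s))) :
    v ∈ LinearMap.range (line i k) := by
  obtain ⟨⟨x, y⟩, h⟩ := hv
  rw [pairWord_apply, Prod.mk.injEq, map_eq_zero_iff _ (line_injective i j)] at h
  obtain ⟨rfl, rfl⟩ := h
  exact ⟨y, by simp⟩

lemma solidWord_fst_mem {j y s} {z : B × B} (hz : z ∈ LinearMap.range (solidWord (j, y, s))) :
    z.1 ∈ LinearMap.range (line 0 j) := by
  obtain ⟨⟨x, c⟩, rfl⟩ := hz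
  rw [solidWord_apply]
  exact ⟨x, rfl⟩

lemma solidWord_fiber {j y s} {v : B} (hv : ((0 : B), v) ∈ LinearMap.range (solidWord (j, y, s))) :
    v ∈ Submodule.span F {line 0 0 (y : Q)} := by
  obtain ⟨⟨x, c⟩, h⟩ := hv
  rw [solidWord_apply, Prod.mk.injEq, map_eq_zero_iff _ (line_injective 0 j)] at h
  obtain ⟨rfl, rfl⟩ := h
  exact Submodule.mem_span_singleton.2 ⟨c, by simp⟩

lemma finrank_span_line_le (y : Q) : finrank F (Submodule.span F {line 0 0 y}) ≤ 1 :=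
  (finrank_span_le_card _).trans (by simp)

lemma graphWord_fiber {M : B →ₗ[F] B} {v : B}
    (hv : ((0 : B), v) ∈ LinearMap.range (graphWord M)) : v = 0 := by
  obtain ⟨x, hx⟩ := hv
  obtain rfl : x = 0 := congrArg Prod.fst hx
  have h : M 0 = v := congrArg Prod.snd hx
  rw [← h, map_zero]

lemma finrank_graphWord_inf_le (M : B →ₗ[F] B) {Z : Submodule F (B × B)} (i : Fin 7) (j : Fin 5)
    (hZ : ∀ z ∈ Z, z.1 ∈ LinearMap.range (line i j)) :
    finrank F ↥(LinearMap.range (graphWord M) ⊓ Z) ≤ 2 := by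
  refine le_trans (finrank_le_of_fst_of_fiber (I := LinearMap.range (line i j)) (J := ⊥)
    (fun z hz => hZ z hz.2) fun v hv => graphWord_fiber hv.1) ?_
  simp [finrank_range_line]

lemma finrank_pairWord_inf_le {a b : (Fin 7 × Fin 5 × Fin 5) × Q} (hab : a ≠ b) :
    finrank F ↥(LinearMap.range (pairWord a) ⊓ LinearMap.range (pairWord b)) ≤ 2 := by
  obtain ⟨⟨i, j, k⟩, s⟩ := a
  obtain ⟨⟨i', j', k'⟩, s'⟩ := b
  have key := finrank_le_of_fst_of_fiber
    (Z := LinearMap.range (pairWord ((i, j, k), s)) ⊓ LinearMap.range (pairWord ((i', j', k'), s')))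
    (J := LinearMap.range (line i k) ⊓ LinearMap.range (line i' k'))
    (I := LinearMap.range (line i j) ⊓ LinearMap.range (line i' j'))
    (fun z hz => ⟨pairWord_fst_mem hz.1, pairWord_fst_mem hz.2⟩)
    (fun v hv => ⟨pairWord_fiber hv.1, pairWord_fiber hv.2⟩)
  have hP := finrank_inf_le_two_left i j (LinearMap.range (line i' j'))
  have hL := finrank_inf_le_two_left i k (LinearMap.range (line i' k'))
  by_cases hi : i = i'
  · subst hi
    by_cases hj : j = j'
    · subst hj
      by_cases hk : k = k'
      · subst hk
        refine le_trans (finrank_le_of_fst_of_fiber (I := ⊥) (J := LinearMap.range (line i k)) ?_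
          fun v hv => pairWord_fiber hv.1) (by simp [finrank_range_line])
        rintro _ ⟨⟨⟨x, y⟩, rfl⟩, ⟨⟨x', y'⟩, h⟩⟩
        rw [pairWord_apply, pairWord_apply, Prod.mk.injEq] at h
        obtain ⟨h1, h2⟩ := h
        obtain rfl := line_injective i j h1
        have h3 : line i (k + 1) (mul (s' - s) x') = line i k (y - y') := by
          simp only [map_sub, LinearMap.sub_apply]
          rw [sub_eq_sub_iff_add_eq_add, h2, add_comm]
        have hk : k + 1 ≠ k := by simp
        rcases eq_zero_of_mul_eq_zero _ _ (line_eq_line hk h3).1 with h4 | h4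
        · exact absurd (by rw [sub_eq_zero.1 h4]) hab
        · simp [pairWord_apply, h4]
      · rw [range_line_inf_eq_bot hk, finrank_bot] at key
        omega
    · rw [range_line_inf_eq_bot hj, finrank_bot] at key
      omega
  · have h1 := finrank_range_line_inf_le (i := i) (i' := i') (j := j) (j' := j') (by simp [hi])
    have h2 := finrank_range_line_inf_le (i := i) (i' := i') (j := k) (j' := k') (by simp [hi])
    omega

lemma finrank_map_ker_linPoly_le (j : Fin 5) {a : Q × Q} (ha : a ≠ 0) :
    finrank F ((LinearMap.ker (linPoly a)).map (line 0 j)) ≤ 1 := by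
  have hne : LinearMap.ker (linPoly a) ≠ ⊤ := by
    refine fun h => ha (eq_zero_of_linPoly_eq_zero a fun x => ?_)
    exact LinearMap.mem_ker.1 (h ▸ Submodule.mem_top)
  have h1 := Submodule.finrank_lt hne
  have h2 := Submodule.finrank_map_le (line 0 j) (LinearMap.ker (linPoly a))
  have h3 : finrank F Q = 2 := by simp
  omega

lemma linPoly_sub (a b : Q × Q) : linPoly (a - b) = linPoly a - linPoly b := by
  ext <;> simp [linPoly] <;> ring

lemma linPoly_zero_left (s : Q) : linPoly (0, s) = mul s := by
  simp [linPoly]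

lemma finrank_solidWord_inf_pairWord_le (a b) :
    finrank F ↥(LinearMap.range (solidWord a) ⊓ LinearMap.range (pairWord b)) ≤ 2 := by
  obtain ⟨j, y, s⟩ := a
  obtain ⟨⟨i', j', k'⟩, s'⟩ := b
  have hspan := finrank_span_line_le (y : Q)
  by_cases hij : ((0 : Fin 7), j) = (i', j')
  · obtain ⟨rfl, rfl⟩ := Prod.mk.inj hij
    by_cases hk : k' = 0
    · subst hk
      have hne : ((y : Q), s - s') ≠ 0 := fun h => y.2 (congrArg Prod.fst h)
      have := finrank_map_ker_linPoly_le j hne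
      refine le_trans (finrank_le_of_fst_of_fiber
        (I := (LinearMap.ker (linPoly (y, s - s'))).map (line 0 j))
        (J := Submodule.span F {line 0 0 (y : Q)}) ?_ fun v hv => solidWord_fiber hv.1)
        (by omega)
      rintro _ ⟨⟨⟨x, c⟩, rfl⟩, ⟨⟨x', c'⟩, h⟩⟩
      rw [pairWord_apply, solidWord_apply, Prod.mk.injEq] at h
      obtain ⟨h1, h2⟩ := h
      obtain rfl := line_injective 0 j h1
      have h3 : line 0 1 (linPoly (y, s - s') x') = line 0 0 (c' - c • (y : Q)) := by
        have h4 : linPoly ((y : Q), s - s') = linPoly (y, s) - mul s' := by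
          rw [← linPoly_zero_left s', ← linPoly_sub]
          exact congrArg linPoly (Prod.ext (sub_zero _).symm rfl)
        rw [h4, LinearMap.sub_apply, map_sub, map_sub, sub_eq_sub_iff_add_eq_add, ← h2, zero_add,
          add_comm]
      rw [solidWord_apply]
      exact ⟨x', (line_eq_line (by decide) h3).1, rfl⟩
    · refine le_trans (finrank_le_of_fst_of_fiber (I := LinearMap.range (line 0 j)) (J := ⊥)
        (fun z hz => solidWord_fst_mem hz.1) fun v hv => ?_) (by simp [finrank_range_line])
      rw [← range_line_inf_eq_bot (i := 0) hk]
      refine Submodule.mem_inf.2 ⟨pairWord_fiber hv.2, ?_⟩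
      exact (Submodule.span_singleton_le_iff_mem _ _).2 (LinearMap.mem_range_self _ (y : Q))
        (solidWord_fiber hv.1)
  · have := finrank_range_line_inf_le hij
    refine le_trans (finrank_le_of_fst_of_fiber
      (I := LinearMap.range (line 0 j) ⊓ LinearMap.range (line i' j'))
      (J := Submodule.span F {line 0 0 (y : Q)})
      (fun z hz => ⟨solidWord_fst_mem hz.1, pairWord_fst_mem hz.2⟩)
      fun v hv => solidWord_fiber hv.1) (by omega)

lemma finrank_solidWord_inf_le {a b : Fin 5 × {y : Q // y ≠ 0} × Q} (hab : a ≠ b) :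
    finrank F ↥(LinearMap.range (solidWord a) ⊓ LinearMap.range (solidWord b)) ≤ 1 := by
  obtain ⟨j, y, s⟩ := a
  obtain ⟨j', y', s'⟩ := b
  have hspan := finrank_span_line_le (y : Q)
  by_cases hj : j = j'
  · subst hj
    have hI : ∀ z ∈ LinearMap.range (solidWord (j, y, s)) ⊓ LinearMap.range (solidWord (j, y', s')),
        z.1 ∈ (LinearMap.ker (linPoly ((y' : Q) - y, s' - s))).map (line 0 j) := by
      rintro _ ⟨⟨⟨x, c⟩, rfl⟩, ⟨⟨x', c'⟩, h⟩⟩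
      rw [solidWord_apply, solidWord_apply, Prod.mk.injEq] at h
      obtain ⟨h1, h2⟩ := h
      obtain rfl := line_injective 0 j h1
      have h3 : line 0 1 (linPoly ((y' : Q) - y, s' - s) x') =
          line 0 0 (c • (y : Q) - c' • (y' : Q)) := by
        rw [← Prod.mk_sub_mk, linPoly_sub, LinearMap.sub_apply, map_sub, map_sub,
          sub_eq_sub_iff_add_eq_add, h2, add_comm]
      rw [solidWord_apply]
      exact ⟨x', (line_eq_line (by decide) h3).1, rfl⟩
    by_cases hy : y = y'
    · subst hy
      refine le_trans (finrank_le_of_fst_of_fiber (I := ⊥) (J := Submodule.span F {line 0 0 (y : Q)})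
        (fun z hz => ?_) fun v hv => solidWord_fiber hv.1) (by simpa using hspan)
      obtain ⟨x, hx, hxz⟩ := hI z hz
      rw [sub_self, linPoly_zero_left] at hx
      rcases eq_zero_of_mul_eq_zero _ _ hx with h | h
      · exact absurd (by rw [sub_eq_zero.1 h]) hab
      · rw [← hxz, h, map_zero]
        exact Submodule.zero_mem _
    · have hne : ((y' : Q) - y, s' - s) ≠ 0 := fun h =>
        hy (Subtype.ext (sub_eq_zero.1 (congrArg Prod.fst h)).symm)
      have := finrank_map_ker_linPoly_le j hne
      refine le_trans (finrank_le_of_fst_of_fiber (J := ⊥) hI fun v hv => ?_) (by simpa using this)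
      obtain ⟨c, hc⟩ := Submodule.mem_span_singleton.1 (solidWord_fiber hv.1)
      obtain ⟨c', hc'⟩ := Submodule.mem_span_singleton.1 (solidWord_fiber hv.2)
      have h1 : c • (y : Q) = c' • (y' : Q) := line_injective 0 0 (by simp [hc, hc'])
      have h2 : ∀ c c' : F, ∀ y y' : Q, y ≠ 0 ∧ y' ≠ 0 ∧ y ≠ y' ∧ c • y = c' • y' → c = 0 := by
        decide +kernel
      rw [← hc, h2 c c' y y' ⟨y.2, y'.2, fun h => hy (Subtype.ext h), h1⟩, zero_smul]
      exact Submodule.zero_mem _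
  · refine le_trans (finrank_le_of_fst_of_fiber (I := ⊥) (J := Submodule.span F {line 0 0 (y : Q)})
      (fun z hz => ?_) fun v hv => solidWord_fiber hv.1) (by simpa using hspan)
    rw [← range_line_inf_eq_bot (i := 0) hj]
    exact ⟨solidWord_fst_mem hz.1, solidWord_fst_mem hz.2⟩

/-- The spaces spanned by a three-dimensional word and an additional basis vector. -/
def coneWord (a : Fin 5 × {y : Q // y ≠ 0} × Q) : (Q × F) × F →ₗ[F] (B × B) × F :=
  (solidWord a).prodMap LinearMap.id

lemma coneWord_injective (a) : Function.Injective (coneWord a) :=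
  (solidWord_injective a).prodMap Function.injective_id

lemma finrank_coneWord_inf_le {a b : Fin 5 × {y : Q // y ≠ 0} × Q} (hab : a ≠ b) :
    finrank F ↥(LinearMap.range (coneWord a) ⊓ LinearMap.range (coneWord b)) ≤ 2 := by
  have := finrank_solidWord_inf_le hab
  refine le_trans (finrank_le_of_fst_of_fiber
    (I := LinearMap.range (solidWord a) ⊓ LinearMap.range (solidWord b)) (J := ⊤) ?_
    fun _ _ => Submodule.mem_top) (by rw [finrank_top, finrank_self]; omega)
  rintro z ⟨⟨x, rfl⟩, ⟨y, hy⟩⟩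
  exact ⟨⟨x.1, rfl⟩, ⟨y.1, congrArg Prod.fst hy⟩⟩

/-- The ambient space of dimension thirteen. -/
abbrev Ambient := (B × B) × (F × B)

theorem exists_isCode : ∃ (ι : Type) (_ : Finite ι) (W : ι → Submodule F Ambient),
    IsCode W ∧ 157396313 ≤ Nat.card ι := by
  obtain ⟨D₀, hD₀, hc₀⟩ := exists_isRankTwoCode (p := 2) B B (by simp) (by simp)
  obtain ⟨D₁, hD₁, hc₁⟩ := exists_isRankTwoCode (p := 2) B (F × B) (by simp) (by simp)
  obtain ⟨D₂, hD₂, hc₂⟩ := exists_isRankTwoCode (p := 2) (Q × Q) (F × B) (by simp) (by simp)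
  obtain ⟨D₃, hD₃, hc₃⟩ := exists_isRankTwoCode (p := 2) ((Q × F) × F) B (by simp) (by simp)
  have h₁ := isCode_lift (by simp) (u := fun M : D₀ => graphWord M)
    (fun M => graphWord_injective M) (fun M M' hM => by
      have h := hD₀ (M - M' : B →ₗ[F] B) (D₀.sub_mem M.2 M'.2) fun h =>
        hM (Subtype.ext (sub_eq_zero.1 h))
      have h' := finrank_range_prod_inf_le LinearMap.id Function.injective_id (M : B →ₗ[F] B) M'
      have h'' : finrank F B = 4 := by simp
      exact h'.trans (Nat.le_of_add_le_add_right (h.trans h''.le))) hD₁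
  have h₂ := isCode_lift (by simp) pairWord_injective (fun _ _ => finrank_pairWord_inf_le) hD₂
  have h₃ := (isCode_lift (by simp) coneWord_injective
    (fun _ _ => finrank_coneWord_inf_le) hD₃).map (LinearEquiv.prodAssoc F (B × B) F B)
  have hmem (a) (M : (Q × F) × F →ₗ[F] B) :
      ∀ z ∈ (LinearMap.range ((coneWord a).prod M)).map
        (LinearEquiv.prodAssoc F (B × B) F B : ((B × B) × F) × B →ₗ[F] Ambient),
        z.1 ∈ LinearMap.range (solidWord a) := by
    rintro _ ⟨_, ⟨x, rfl⟩, rfl⟩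
    exact ⟨x.1, rfl⟩
  have : Finite D₀ := Module.finite_of_finite F
  have : Finite D₁ := Module.finite_of_finite F
  have : Finite D₂ := Module.finite_of_finite F
  have : Finite D₃ := Module.finite_of_finite F
  refine ⟨_, inferInstance, _, (h₁.sumElim h₂ ?_).sumElim h₃ ?_, ?_⟩
  · rintro ⟨M, N⟩ ⟨⟨⟨i, j, k⟩, s⟩, N'⟩
    refine (finrank_range_prod_inf_le_of_mem (graphWord_injective M) _ _ ?_).trans
      (finrank_graphWord_inf_le _ i j fun z hz => pairWord_fst_mem (k := k) (s := s) hz)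
    rintro _ ⟨x, rfl⟩
    exact ⟨x, rfl⟩
  · rintro (⟨M, N⟩ | ⟨b, N⟩) ⟨⟨j, y, s⟩, N'⟩
    · exact (finrank_range_prod_inf_le_of_mem (graphWord_injective M) _ _ (hmem _ _)).trans
        (finrank_graphWord_inf_le _ 0 j fun z hz => solidWord_fst_mem hz)
    · refine (finrank_range_prod_inf_le_of_mem (pairWord_injective b) _ _ (hmem _ _)).trans ?_
      rw [inf_comm]
      exact finrank_solidWord_inf_pairWord_le _ _
  · simp only [Nat.card_sum, Nat.card_prod, Module.natCard_eq_pow_finrank (K := F) (V := D₀),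
      Module.natCard_eq_pow_finrank (K := F) (V := D₁),
      Module.natCard_eq_pow_finrank (K := F) (V := D₂),
      Module.natCard_eq_pow_finrank (K := F) (V := D₃)]
    have hy : Nat.card {y : Q // y ≠ 0} = 3 := by
      rw [Nat.card_eq_fintype_card]
      decide +kernel
    simp at hc₀ hc₁ hc₂ hc₃
    have e₀ : 2 ^ 12 ≤ 2 ^ finrank F D₀ := Nat.pow_le_pow_right (by simp) (by omega)
    have e₁ : 2 ^ 15 ≤ 2 ^ finrank F D₁ := Nat.pow_le_pow_right (by simp) (by omega)
    have e₂ : 2 ^ 15 ≤ 2 ^ finrank F D₂ := Nat.pow_le_pow_right (by simp) (by omega)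
    have e₃ : 2 ^ 12 ≤ 2 ^ finrank F D₃ := Nat.pow_le_pow_right (by simp) (by omega)
    have := Nat.mul_le_mul e₀ e₁
    simp only [hy, Nat.card_eq_fintype_card, Fintype.card_fin, ZMod.card]
    omega

end SubspaceCode

theorem statement11 :
    ∃ S : Set (Submodule (ZMod 2) (Fin 13 → ZMod 2)),
      S.ncard = 157396313 ∧
      (∀ X ∈ S, Module.finrank (ZMod 2) ↥X = 4) ∧
      (∀ X ∈ S, ∀ Y ∈ S, X ≠ Y → 4 ≤ subspaceDist X Y) := by
  obtain ⟨ι, _, W, hW, hcard⟩ := SubspaceCode.exists_isCode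
  have e : SubspaceCode.Ambient ≃ₗ[ZMod 2] (Fin 13 → ZMod 2) :=
    LinearEquiv.ofFinrankEq _ _ (by simp)
  exact (hW.map e).exists_set hcard
end
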